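/- Let I be a Cohen-Macaulay R-ideal of positive grade. Then ∫I = I if and only if I is maximal in its linkage class and I is not the maximal ideal of a regular local ring. -/

import Mathlib

open RingTheory IsLocalRing

/-- A proper ideal generated by a regular sequence is a complete intersection. -/
def IsCompleteIntersectionIdeal (R : Type) [CommRing R] (I : Ideal R) : Prop :=
  I ≠ ⊤ ∧ ∃ rs : List R, RingTheory.Sequence.IsRegular R rs ∧ Ideal.ofList rs = I

/-- Two proper ideals are directly linked if there is a complete intersection
`c ⊆ I ⊓ J` with `I = c : J` and `J = c : I`. -/
def IsDirectlyLinked (R : Type) [CommRing R] (I J : Ideal R) : Prop :=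
  I ≠ ⊤ ∧ J ≠ ⊤ ∧ ∃ c : Ideal R, IsCompleteIntersectionIdeal R c ∧ c ≤ I ⊓ J ∧
    Submodule.colon c J = I ∧ Submodule.colon c I = J

/-- The linkage (liaison) equivalence: the equivalence relation generated by direct linkage. -/
def InSameLinkageClass (R : Type) [CommRing R] (I J : Ideal R) : Prop :=
  Relation.EqvGen (IsDirectlyLinked R) I J

/-- An ideal is licci if its linkage class contains a complete intersection. -/
def Licci (R : Type) [CommRing R] (I : Ideal R) : Prop :=
  ∃ J, InSameLinkageClass R I J ∧ IsCompleteIntersectionIdeal R J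

open Classical in
/-- `∫ I` : the sum of all ideals in the linkage class of `I` if `I` is not licci,
and the unit ideal otherwise. -/
noncomputable def intLink (R : Type) [CommRing R] (I : Ideal R) : Ideal R :=
  if Licci R I then ⊤ else sSup {J : Ideal R | InSameLinkageClass R I J}

/-- An ideal is maximal in its linkage class if it contains every ideal in its linkage class. -/
def MaximalInLinkageClass (R : Type) [CommRing R] (I : Ideal R) : Prop :=
  ∀ J, InSameLinkageClass R I J → J ≤ I

/-- Linked in `n` steps. -/
def LinkedInSteps (R : Type) [CommRing R] : ℕ → Ideal R → Ideal R → Prop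
  | 0, I, J => I = J
  | (n+1), I, J => ∃ K, IsDirectlyLinked R I K ∧ LinkedInSteps R n K J

/-- The grade of an ideal: the supremum of lengths of regular sequences contained in it. -/
noncomputable def gradeOf (R : Type) [CommRing R] (I : Ideal R) : ℕ :=
  sSup {n : ℕ | ∃ rs : List R, rs.length = n ∧ (∀ r ∈ rs, r ∈ I) ∧
    RingTheory.Sequence.IsRegular R rs}

/-- A Noetherian local ring is Cohen-Macaulay if its depth (the grade of its maximal ideal)
equals its Krull dimension. -/
def IsCMLocalRing (A : Type) [CommRing A] [IsLocalRing A] : Prop :=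
  ringKrullDim A = (gradeOf A (maximalIdeal A) : WithBot (WithTop ℕ))

/-- An ideal `I` of `R` is a Cohen-Macaulay ideal if `R/I` is a Cohen-Macaulay local ring. -/
def IsCMIdeal (R : Type) [CommRing R] (I : Ideal R) : Prop :=
  ∃ h : IsLocalRing (R ⧸ I), @IsCMLocalRing (R ⧸ I) _ h

/-- A Noetherian local ring is Gorenstein if it is Cohen-Macaulay and some ideal generated
by a regular sequence and primary to the maximal ideal is irreducible. -/
def IsGorensteinLocalRing (A : Type) [CommRing A] [IsLocalRing A] : Prop :=
  IsCMLocalRing A ∧ ∃ rs : List A, RingTheory.Sequence.IsRegular A rs ∧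
    (Ideal.ofList rs).radical = maximalIdeal A ∧ InfIrred (Ideal.ofList rs)

/-- A Noetherian local ring is regular if and only if its maximal ideal can be generated
by a regular sequence; we take this as the definition. -/
def IsRegularLocalRingP (A : Type) [CommRing A] [IsLocalRing A] : Prop :=
  IsNoetherianRing A ∧ ∃ rs : List A, RingTheory.Sequence.IsRegular A rs ∧
    Ideal.ofList rs = IsLocalRing.maximalIdeal A

section

open CategoryTheory Abelian Module RingTheory.Sequence

/-- The Rees computation of `Ext N M` up to the length of an `M`-regular sequence killing `N`. -/
theorem ext_rees {R : Type} [CommRing R] (N M : ModuleCat.{0} R) (rs : List R)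
    (hreg : IsWeaklyRegular M rs) (hann : ∀ r ∈ rs, r ∈ Module.annihilator R N) :
    (∀ i < rs.length, Subsingleton (Ext N M i)) ∧
      Nonempty (Ext N M rs.length ≃ₗ[R] (N →ₗ[R] M ⧸ Ideal.ofList rs • (⊤ : Submodule R M))) := by
  induction rs generalizing M with
  | nil =>
    refine ⟨by simp, ⟨Ext.linearEquiv₀.trans (ModuleCat.homLinearEquiv.trans
      (LinearEquiv.congrRight (Submodule.quotEquivOfEqBot _ (by simp)).symm))⟩⟩
  | cons r rs ih =>
    rw [isWeaklyRegular_cons_iff] at hreg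
    have hS := hreg.1.smulShortComplex_shortExact
    obtain ⟨hvan, ⟨e⟩⟩ := ih (ModuleCat.of R (QuotSMulTop r M)) hreg.2
      (fun s hs => hann s (List.mem_cons_of_mem _ hs))
    have hzero : ∀ (i : ℕ) (x : Ext N M i),
        x.comp (Ext.mk₀ (M.smulShortComplex r).f) (add_zero i) = 0 := by
      intro i x
      have := ConcreteCategory.congr_hom (Ext.postcomp_smul_id_eq_zero_of_mem_annihilator
        (M := M) (hann r List.mem_cons_self) i) x
      exact this
    have hvan' : ∀ i < rs.length + 1, Subsingleton (Ext N M i) := by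
      intro i hi
      refine subsingleton_of_forall_eq 0 fun x => ?_
      cases i with
      | zero =>
        have := hS.mono_f
        exact Ext.postcomp_mk₀_injective_of_mono N (M.smulShortComplex r).f
          ((hzero 0 x).trans (map_zero _).symm)
      | succ i =>
        obtain ⟨y, rfl⟩ := Ext.covariant_sequence_exact₁ N hS x (hzero _ x) rfl
        have := hvan i (by omega)
        rw [show y = 0 from
          Subsingleton.elim (α := Ext N (ModuleCat.of R (QuotSMulTop r M)) i) _ _, Ext.zero_comp]
        rfl
    refine ⟨hvan', ⟨?_⟩⟩
    let δ := hS.extClass.postcompOfLinear R N (rfl : rs.length + 1 = rs.length + 1)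
    have hδ : Function.Bijective δ := by
      constructor
      · rw [injective_iff_map_eq_zero]
        intro x hx
        obtain ⟨y, rfl⟩ := Ext.covariant_sequence_exact₃ N hS x rfl hx
        have := hvan' rs.length (by omega)
        rw [show y = 0 from Subsingleton.elim (α := Ext N M rs.length) _ _, Ext.zero_comp]
      · intro x
        exact Ext.covariant_sequence_exact₁ N hS x (hzero _ x) rfl
    exact (LinearEquiv.ofBijective δ hδ).symm.trans (e.trans (LinearEquiv.congrRight
      (Submodule.quotOfListConsSMulTopEquivQuotSMulTopInner M r rs).symm))

/-- A module has finite projective dimension. -/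
def HasFiniteProjDim {R : Type} [CommRing R] (X : ModuleCat.{0} R) : Prop :=
  ∃ n, HasProjectiveDimensionLT X n

namespace HasFiniteProjDim

variable {R : Type} [CommRing R] {X Y Z : ModuleCat.{0} R}

theorem of_projective [Module.Projective R X] : HasFiniteProjDim X :=
  ⟨1, inferInstance⟩

theorem of_linearEquiv (e : X ≃ₗ[R] Y) : HasFiniteProjDim X → HasFiniteProjDim Y
  | ⟨n, _⟩ => ⟨n, hasProjectiveDimensionLT_of_iso e.toModuleIso n⟩

theorem X₃ {f : X →ₗ[R] Y} {g : Y →ₗ[R] Z} (hf : Function.Injective f)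
    (hfg : Function.Exact f g) (hg : Function.Surjective g) :
    HasFiniteProjDim X → HasFiniteProjDim Y → HasFiniteProjDim Z
  | ⟨a, _⟩, ⟨b, _⟩ =>
    ⟨max a b + 1, (ModuleCat.shortComplex_shortExact
      (ModuleCat.shortComplexOfCompEqZero f g hfg.linearMap_comp_eq_zero)
      hfg hf hg).hasProjectiveDimensionLT_X₃ (max a b)
      (hasProjectiveDimensionLT_of_ge X a _ (by simp))
      (hasProjectiveDimensionLT_of_ge Y b _ (by omega))⟩

theorem X₁ {f : X →ₗ[R] Y} {g : Y →ₗ[R] Z} (hf : Function.Injective f)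
    (hfg : Function.Exact f g) (hg : Function.Surjective g) :
    HasFiniteProjDim Y → HasFiniteProjDim Z → HasFiniteProjDim X
  | ⟨a, _⟩, ⟨b, _⟩ =>
    ⟨max a b, (ModuleCat.shortComplex_shortExact
      (ModuleCat.shortComplexOfCompEqZero f g hfg.linearMap_comp_eq_zero)
      hfg hf hg).hasProjectiveDimensionLT_X₁ (max a b)
      (hasProjectiveDimensionLT_of_ge Y a _ (by simp))
      (hasProjectiveDimensionLT_of_ge Z b _ (by omega))⟩

theorem of_exact_four {W : ModuleCat.{0} R} {f : X →ₗ[R] Y} {g : Y →ₗ[R] Z} {h : Z →ₗ[R] W}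
    (hf : Function.Injective f) (hfg : Function.Exact f g) (hgh : Function.Exact g h)
    (hh : Function.Surjective h) (hX : HasFiniteProjDim X) (hY : HasFiniteProjDim Y)
    (hZ : HasFiniteProjDim Z) : HasFiniteProjDim W := by
  refine X₃ (X := ModuleCat.of R (LinearMap.range g)) (f := (LinearMap.range g).subtype)
    (g := h) (Submodule.injective_subtype _) ?_ hh
    (X₃ (f := f) (g := g.rangeRestrict) hf ?_ g.surjective_rangeRestrict hX hY) hZ
  · intro z
    rw [hgh z]
    simp
  · intro y
    rw [← hfg y]
    simp [Subtype.ext_iff]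

end HasFiniteProjDim

theorem hasFiniteProjDim_ext_zero_of_projective {R : Type} [CommRing R] (X : ModuleCat.{0} R)
    [Module.Finite R X] [Module.Projective R X] :
    HasFiniteProjDim (ModuleCat.of R (Ext X (ModuleCat.of R R) 0)) :=
  .of_linearEquiv (X := ModuleCat.of R (Module.Dual R X))
    (Ext.linearEquiv₀.trans ModuleCat.homLinearEquiv).symm .of_projective

theorem hasFiniteProjDim_ext_succ {R : Type} [CommRing R] [IsNoetherianRing R] (g : ℕ)
    (X : ModuleCat.{0} R) [Module.Finite R X] (hX : HasProjectiveDimensionLT X (g + 2))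
    (hvan : ∀ i, 0 < i → i ≤ g → Subsingleton (Ext X (ModuleCat.of R R) i))
    (h0 : HasFiniteProjDim (ModuleCat.of R (Ext X (ModuleCat.of R R) 0))) :
    HasFiniteProjDim (ModuleCat.of R (Ext X (ModuleCat.of R R) (g + 1))) := by
  induction g generalizing X with
  | zero =>
    obtain ⟨F, _, _, _, _, f, hf⟩ := Module.exists_finite_presentation R X
    have hS := LinearMap.shortExact_shortComplexKer hf
    have hK : Projective f.shortComplexKer.X₁ := projective_iff_hasProjectiveDimensionLT_one.mpr
      ((hS.hasProjectiveDimensionLT_X₃_iff 0 inferInstance).mp hX)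
    have : Module.Projective R f.shortComplexKer.X₁ := (IsProjective.iff_projective _).mpr hK
    have : Module.Finite R f.shortComplexKer.X₁ :=
      inferInstanceAs (Module.Finite R (LinearMap.ker f))
    refine HasFiniteProjDim.of_exact_four
      (f := (Ext.mk₀ f.shortComplexKer.g).precompOfLinear R (ModuleCat.of R R) (zero_add 0))
      (g := (Ext.mk₀ f.shortComplexKer.f).precompOfLinear R (ModuleCat.of R R) (zero_add 0))
      (h := hS.extClass.precompOfLinear R (ModuleCat.of R R) (add_comm 1 0))
      ?_ ?_ ?_ ?_ h0
      (hasFiniteProjDim_ext_zero_of_projective (ModuleCat.of R F))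
      (hasFiniteProjDim_ext_zero_of_projective f.shortComplexKer.X₁)
    · have := hS.epi_g
      exact Ext.precomp_mk₀_injective_of_epi _ f.shortComplexKer.g
    · exact (ShortComplex.ab_exact_iff_function_exact _).mp
        (Ext.contravariant_sequence_exact₂' hS (ModuleCat.of R R) 0)
    · exact (ShortComplex.ab_exact_iff_function_exact _).mp
        (Ext.contravariant_sequence_exact₁' hS (ModuleCat.of R R) 0 1 (add_comm 1 0))
    · have : Projective f.shortComplexKer.X₂ := inferInstance
      exact precomp_extClass_surjective_of_projective_X₂ (ModuleCat.of R R) hS 0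
  | succ g ih =>
    obtain ⟨F, _, _, _, _, f, hf⟩ := Module.exists_finite_presentation R X
    have hS := LinearMap.shortExact_shortComplexKer hf
    have hproj : Projective f.shortComplexKer.X₂ := inferInstance
    have hK : HasProjectiveDimensionLT f.shortComplexKer.X₁ (g + 2) :=
      (hS.hasProjectiveDimensionLT_X₃_iff (g + 1) inferInstance).mp hX
    have : Module.Finite R f.shortComplexKer.X₁ :=
      inferInstanceAs (Module.Finite R (LinearMap.ker f))
    have hbij : ∀ i, Function.Bijective
        (hS.extClass.precompOfLinear R (ModuleCat.of R R) (add_comm 1 (i + 1))) := by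
      intro i
      refine ⟨?_, precomp_extClass_surjective_of_projective_X₂ (ModuleCat.of R R) hS (i + 1)⟩
      rw [injective_iff_map_eq_zero]
      intro x hx
      obtain ⟨y, rfl⟩ := Ext.contravariant_sequence_exact₁ hS _ x (add_comm 1 (i + 1)) hx
      rw [Ext.eq_zero_of_projective y, Ext.comp_zero]
    refine .of_linearEquiv
      (X := ModuleCat.of R (Ext f.shortComplexKer.X₁ (ModuleCat.of R R) (g + 1)))
      (LinearEquiv.ofBijective _ (hbij g)) (ih f.shortComplexKer.X₁ hK ?_ ?_)
    · intro i hi hig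
      obtain ⟨j, rfl⟩ := Nat.exists_eq_succ_of_ne_zero hi.ne'
      have := hvan (j + 2) (by omega) (by omega)
      exact (hbij j).1.subsingleton
    · refine HasFiniteProjDim.X₃
        (f := (Ext.mk₀ f.shortComplexKer.g).precompOfLinear R (ModuleCat.of R R) (zero_add 0))
        (g := (Ext.mk₀ f.shortComplexKer.f).precompOfLinear R (ModuleCat.of R R) (zero_add 0))
        ?_ ?_ ?_ h0 (hasFiniteProjDim_ext_zero_of_projective (ModuleCat.of R F))
      · have := hS.epi_g
        exact Ext.precomp_mk₀_injective_of_epi _ f.shortComplexKer.g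
      · exact (ShortComplex.ab_exact_iff_function_exact _).mp
          (Ext.contravariant_sequence_exact₂' hS (ModuleCat.of R R) 0)
      · intro x
        have := hvan 1 (by omega) (by omega)
        exact Ext.contravariant_sequence_exact₁ hS _ x (add_comm 1 0)
          (Subsingleton.elim (α := Ext X (ModuleCat.of R R) 1) _ _)

theorem hasFiniteProjDim_ext {R : Type} [CommRing R] [IsNoetherianRing R] (g : ℕ)
    (X : ModuleCat.{0} R) [Module.Finite R X] (hX : HasProjectiveDimensionLT X (g + 1))
    (hvan : ∀ i < g, Subsingleton (Ext X (ModuleCat.of R R) i)) :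
    HasFiniteProjDim (ModuleCat.of R (Ext X (ModuleCat.of R R) g)) := by
  cases g with
  | zero =>
    have : Module.Projective R X := (IsProjective.iff_projective _).mpr
      (projective_iff_hasProjectiveDimensionLT_one.mpr hX)
    exact hasFiniteProjDim_ext_zero_of_projective X
  | succ g =>
    have := hvan 0 (by omega)
    exact hasFiniteProjDim_ext_succ g X hX (fun i _ hi => hvan i (by omega))
      (HasFiniteProjDim.of_projective)

section
variable {R : Type} [CommRing R]

theorem smul_ext_quotient_eq_zero {I : Ideal R} {a : R} (ha : a ∈ I) {M : ModuleCat.{0} R} {n : ℕ}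
    (x : Ext (ModuleCat.of R (R ⧸ I)) M n) : a • x = 0 := by
  have h : a • 𝟙 (ModuleCat.of R (R ⧸ I)) = 0 := by
    refine ModuleCat.hom_ext (LinearMap.ext fun y => ?_)
    obtain ⟨y, rfl⟩ := Ideal.Quotient.mk_surjective y
    exact Ideal.Quotient.eq_zero_iff_mem.mpr (I.mul_mem_right y ha)
  rw [← Ext.mk₀_id_comp x, ← Ext.smul_comp, ← Ext.mk₀_smul, h, Ext.mk₀_zero, Ext.zero_comp]

theorem ext_comp_toSpanSingleton_eq_zero {I : Ideal R} {M : ModuleCat.{0} R} {w : M}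
    (hw : w ∈ I • (⊤ : Submodule R M)) {n : ℕ}
    (x : Ext (ModuleCat.of R (R ⧸ I)) (ModuleCat.of R R) n) :
    x.comp (Ext.mk₀ (ModuleCat.ofHom (LinearMap.toSpanSingleton R M w))) (add_zero n) = 0 := by
  induction hw using Submodule.smul_induction_on' with
  | smul a ha y _ =>
    have : ModuleCat.ofHom (LinearMap.toSpanSingleton R M (a • y)) =
        a • ModuleCat.ofHom (LinearMap.toSpanSingleton R M y) := by
      ext
      simp
    rw [this, Ext.mk₀_smul, Ext.comp_smul, smul_ext_quotient_eq_zero ha]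
  | add y _ z _ hy hz =>
    have : ModuleCat.ofHom (LinearMap.toSpanSingleton R M (y + z)) =
        ModuleCat.ofHom (LinearMap.toSpanSingleton R M y) +
        ModuleCat.ofHom (LinearMap.toSpanSingleton R M z) := by
      ext
      simp
    rw [this, Ext.mk₀_add, Ext.comp_add, hy, hz, add_zero]

variable [IsLocalRing R]

theorem exists_dual_eq_one_of_notMem_smul_top {M : Type} [AddCommGroup M] [Module R M]
    [Module.Free R M] {v : M} (hv : v ∉ maximalIdeal R • (⊤ : Submodule R M)) :
    ∃ φ : M →ₗ[R] R, φ v = 1 := by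
  let b := Module.Free.chooseBasis R M
  by_contra! h
  apply hv
  rw [← b.linearCombination_repr v, Finsupp.linearCombination_apply]
  refine Submodule.sum_mem _ fun i _ => Submodule.smul_mem_smul ?_ trivial
  rw [mem_maximalIdeal, mem_nonunits_iff]
  rintro ⟨u, hu⟩
  apply h ((↑u⁻¹ : R) • b.coord i)
  simp [← hu]

theorem residueField_one_tmul_eq_zero_iff {M : Type} [AddCommGroup M] [Module R M] (v : M) :
    (TensorProduct.tmul R (1 : ResidueField R) v = 0) ↔
      v ∈ maximalIdeal R • (⊤ : Submodule R M) := by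
  rw [← Submodule.Quotient.mk_eq_zero (maximalIdeal R • (⊤ : Submodule R M))]
  have := TensorProduct.quotTensorEquivQuotSMul_mk_tmul (M := M) (maximalIdeal R) 1 v
  rw [one_smul] at this
  exact (TensorProduct.quotTensorEquivQuotSMul M (maximalIdeal R)).map_eq_zero_iff.symm.trans
    (Eq.congr_left this)

theorem subsingleton_ext_pi {R : Type} [CommRing R] {ι : Type} [Fintype ι] [DecidableEq ι]
    {X : ModuleCat.{0} R} {i : ℕ} (h : Subsingleton (Ext X (ModuleCat.of R R) i)) :
    Subsingleton (Ext X (ModuleCat.of R (ι → R)) i) := by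
  refine subsingleton_of_forall_eq 0 fun x => ?_
  have hid : 𝟙 (ModuleCat.of R (ι → R)) =
      ∑ k, ModuleCat.ofHom (LinearMap.proj (R := R) (φ := fun _ : ι => R) k) ≫
        ModuleCat.ofHom (LinearMap.single R (fun _ : ι => R) k) := by
    refine ModuleCat.hom_ext (LinearMap.ext fun y => ?_)
    simp [ModuleCat.hom_sum, LinearMap.sum_apply, Finset.univ_sum_single]
  rw [← Ext.comp_mk₀_id x, hid, Ext.mk₀_sum, Ext.comp_sum]
  refine Finset.sum_eq_zero fun k _ => ?_
  rw [← Ext.mk₀_comp_mk₀, ← Ext.comp_assoc_of_second_deg_zero,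
    Subsingleton.elim (x.comp _ (add_zero i)) 0, Ext.zero_comp]

variable [IsNoetherianRing R]

/-- The Auslander-Buchsbaum bound for projective dimension at most one. -/
theorem projective_of_ext_residueField {g : ℕ}
    (hg : ¬ Subsingleton (Ext (ModuleCat.of R (R ⧸ maximalIdeal R)) (ModuleCat.of R R) g))
    {N : ModuleCat.{0} R} [Module.Finite R N] (hN : HasProjectiveDimensionLT N 2)
    (hvan : ∀ i < g, Subsingleton (Ext (ModuleCat.of R (R ⧸ maximalIdeal R)) N i)) :
    Projective N := by
  obtain ⟨F, _, _, _, _, f, hf⟩ := Module.exists_finite_presentation R N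
  have hS := LinearMap.shortExact_shortComplexKer hf
  have hK : Projective f.shortComplexKer.X₁ := projective_iff_hasProjectiveDimensionLT_one.mpr
    ((hS.hasProjectiveDimensionLT_X₃_iff 0 inferInstance).mp hN)
  have : Module.Projective R (LinearMap.ker f) :=
    (IsProjective.iff_projective (f.shortComplexKer.X₁)).mpr hK
  have : Module.Free R (LinearMap.ker f) := Module.free_of_flat_of_isLocalRing
  have hinj : ∀ x : Ext (ModuleCat.of R (R ⧸ maximalIdeal R)) f.shortComplexKer.X₁ g,
      x.comp (Ext.mk₀ f.shortComplexKer.f) (add_zero g) = 0 → x = 0 := by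
    intro x hx
    cases g with
    | zero =>
      have := hS.mono_f
      exact Ext.postcomp_mk₀_injective_of_mono _ f.shortComplexKer.f (hx.trans (map_zero _).symm)
    | succ g =>
      obtain ⟨y, rfl⟩ := Ext.covariant_sequence_exact₁ _ hS x hx rfl
      have := hvan g (by omega)
      rw [show y = 0 from Subsingleton.elim (α := Ext _ N g) _ _, Ext.zero_comp]
  have hfree : Module.Free R N := by
    refine Module.free_of_lTensor_residueField_injective (LinearMap.ker f).subtype f hf
      (LinearMap.exact_subtype_ker_map f) ?_
    rw [injective_iff_map_eq_zero]
    intro t ht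
    obtain ⟨v, rfl⟩ := TensorProduct.mk_surjective R (LinearMap.ker f) (ResidueField R)
      IsLocalRing.residue_surjective t
    simp only [TensorProduct.mk_apply, LinearMap.lTensor_tmul] at ht ⊢
    rw [residueField_one_tmul_eq_zero_iff] at ht ⊢
    by_contra hv
    obtain ⟨φ, hφ⟩ := exists_dual_eq_one_of_notMem_smul_top hv
    refine hg (subsingleton_of_forall_eq 0 fun x => ?_)
    let ψ : ModuleCat.of R R ⟶ f.shortComplexKer.X₁ :=
      ModuleCat.ofHom (LinearMap.toSpanSingleton R (LinearMap.ker f) v)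
    have h1 : x.comp (Ext.mk₀ ψ) (add_zero g) = 0 := by
      apply hinj
      rw [Ext.comp_assoc_of_second_deg_zero, Ext.mk₀_comp_mk₀]
      have : ψ ≫ f.shortComplexKer.f = ModuleCat.ofHom (LinearMap.toSpanSingleton R F v) := by
        ext
        simp [ψ]
      rw [this]
      exact ext_comp_toSpanSingleton_eq_zero (M := ModuleCat.of R F) ht x
    have h2 : ψ ≫ ModuleCat.ofHom φ = 𝟙 _ := by
      ext
      simp [ψ, hφ]
    rw [← Ext.comp_mk₀_id x, ← h2, ← Ext.mk₀_comp_mk₀, ← Ext.comp_assoc_of_second_deg_zero, h1,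
      Ext.zero_comp]
  have : Module.Projective R N := Module.Projective.of_free
  exact (IsProjective.iff_projective N).mp this

theorem hasProjectiveDimensionLT_of_ext_residueField {g : ℕ}
    (hlt : ∀ i < g, Subsingleton (Ext (ModuleCat.of R (R ⧸ maximalIdeal R)) (ModuleCat.of R R) i))
    (hg : ¬ Subsingleton (Ext (ModuleCat.of R (R ⧸ maximalIdeal R)) (ModuleCat.of R R) g))
    (n j : ℕ) (hj : g ≤ n + j)
    (N : ModuleCat.{0} R) [Module.Finite R N] (hN : HasProjectiveDimensionLT N (n + 2))
    (hvan : ∀ i < j, Subsingleton (Ext (ModuleCat.of R (R ⧸ maximalIdeal R)) N i)) :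
    HasProjectiveDimensionLT N (n + 1) := by
  induction n generalizing N j with
  | zero =>
    exact projective_iff_hasProjectiveDimensionLT_one.mp
      (projective_of_ext_residueField hg hN fun i hi => hvan i (by omega))
  | succ n ih =>
    obtain ⟨m, f, hf⟩ := Module.Finite.exists_fin' R N
    have hS := LinearMap.shortExact_shortComplexKer hf
    have : Module.Finite R f.shortComplexKer.X₁ :=
      inferInstanceAs (Module.Finite R (LinearMap.ker f))
    rw [hS.hasProjectiveDimensionLT_X₃_iff (n + 1) inferInstance] at hN
    rw [hS.hasProjectiveDimensionLT_X₃_iff n inferInstance]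
    refine ih (min (j + 1) g) (by omega) f.shortComplexKer.X₁ hN fun i hi => ?_
    have hF : Subsingleton (Ext (ModuleCat.of R (R ⧸ maximalIdeal R)) f.shortComplexKer.X₂ i) :=
      subsingleton_ext_pi (hlt i (by omega))
    refine subsingleton_of_forall_eq 0 fun x => ?_
    have hx : x.comp (Ext.mk₀ f.shortComplexKer.f) (add_zero i) = 0 := Subsingleton.elim _ _
    cases i with
    | zero =>
      have := hS.mono_f
      exact Ext.postcomp_mk₀_injective_of_mono _ f.shortComplexKer.f (hx.trans (map_zero _).symm)
    | succ i =>
      obtain ⟨y, rfl⟩ := Ext.covariant_sequence_exact₁ _ hS x hx rfl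
      have := hvan i (by omega)
      rw [show y = 0 from Subsingleton.elim (α := Ext _ N i) _ _, Ext.zero_comp]

/-- The Auslander-Buchsbaum bound on a finite projective dimension. -/
theorem HasFiniteProjDim.hasProjectiveDimensionLT {g : ℕ}
    (hlt : ∀ i < g, Subsingleton (Ext (ModuleCat.of R (R ⧸ maximalIdeal R)) (ModuleCat.of R R) i))
    (hg : ¬ Subsingleton (Ext (ModuleCat.of R (R ⧸ maximalIdeal R)) (ModuleCat.of R R) g))
    {N : ModuleCat.{0} R} [Module.Finite R N] (hN : HasFiniteProjDim N) :
    HasProjectiveDimensionLT N (g + 1) := by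
  obtain ⟨n, hn⟩ := hN
  induction n with
  | zero => exact hasProjectiveDimensionLT_of_ge N 0 _ (by omega)
  | succ n ih =>
    by_cases h : n + 1 ≤ g + 1
    · exact hasProjectiveDimensionLT_of_ge N _ _ h
    · obtain ⟨n, rfl⟩ : ∃ l, n = l + 1 := ⟨n - 1, by omega⟩
      exact ih (hasProjectiveDimensionLT_of_ext_residueField hlt hg n 0 (by omega) N hn (by simp))

end

section
variable {R : Type} [CommRing R]

/-- `g` is the least degree in which `Ext R (R ⧸ I) R` does not vanish. -/
def IsExtGrade (I : Ideal R) (g : ℕ) : Prop :=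
  (∀ i < g, Subsingleton (Ext (ModuleCat.of R (R ⧸ I)) (ModuleCat.of R R) i)) ∧
    ¬ Subsingleton (Ext (ModuleCat.of R (R ⧸ I)) (ModuleCat.of R R) g)

theorem IsExtGrade.unique {I : Ideal R} {g h : ℕ} (hg : IsExtGrade I g) (hh : IsExtGrade I h) :
    g = h :=
  le_antisymm (not_lt.mp fun hlt => hh.2 (hg.1 h hlt)) (not_lt.mp fun hlt => hg.2 (hh.1 g hlt))

theorem ext_rees_quotient {I : Ideal R} {rs : List R} (hrs : IsWeaklyRegular R rs)
    (hI : Ideal.ofList rs ≤ I) :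
    (∀ i < rs.length, Subsingleton (Ext (ModuleCat.of R (R ⧸ I)) (ModuleCat.of R R) i)) ∧
      Nonempty (Ext (ModuleCat.of R (R ⧸ I)) (ModuleCat.of R R) rs.length ≃ₗ[R]
        (R ⧸ I →ₗ[R] R ⧸ Ideal.ofList rs)) := by
  have h := ext_rees (ModuleCat.of R (R ⧸ I)) (ModuleCat.of R R) rs hrs fun r hr => by
    rw [show Module.annihilator R (ModuleCat.of R (R ⧸ I)) = I from Ideal.annihilator_quotient]
    exact hI (Ideal.subset_span hr)
  have hc : Ideal.ofList rs • (⊤ : Submodule R (ModuleCat.of R R)) = Ideal.ofList rs :=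
    Ideal.mul_top _
  rw [hc] at h
  exact h

variable {I J c : Ideal R}

theorem applyₗ_one_injective_of_quotient {M : Type*} [AddCommGroup M] [Module R M] :
    Function.Injective (LinearMap.applyₗ (1 : R ⧸ I) : (R ⧸ I →ₗ[R] M) →ₗ[R] M) := by
  intro φ ψ h
  refine LinearMap.ext fun y => ?_
  obtain ⟨y, rfl⟩ := Ideal.Quotient.mk_surjective y
  have : (Ideal.Quotient.mk I y) = y • (1 : R ⧸ I) := by
    rw [Algebra.smul_def, mul_one]
    rfl
  rw [this, map_smul, map_smul]
  exact congrArg (y • ·) h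

theorem exact_applyₗ_one_factor (hcJ : c ≤ J) (hJ : Submodule.colon c I = J) :
    Function.Exact (LinearMap.applyₗ (1 : R ⧸ I) : (R ⧸ I →ₗ[R] R ⧸ c) →ₗ[R] R ⧸ c)
      (Submodule.factor hcJ) := by
  intro y
  obtain ⟨y, rfl⟩ := Submodule.Quotient.mk_surjective c y
  have h1 : Submodule.factor hcJ (Submodule.Quotient.mk y) = 0 ↔ y ∈ J :=
    Submodule.Quotient.mk_eq_zero J
  rw [h1, ← hJ, Submodule.mem_colon]
  constructor
  · intro h
    refine ⟨Submodule.liftQ I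
      (LinearMap.toSpanSingleton R (R ⧸ c) (Submodule.Quotient.mk y)) ?_, ?_⟩
    · intro s hs
      rw [LinearMap.mem_ker, LinearMap.toSpanSingleton_apply, ← Submodule.Quotient.mk_smul,
        Submodule.Quotient.mk_eq_zero, smul_eq_mul, mul_comm]
      exact h s hs
    · exact one_smul R (Submodule.Quotient.mk y : R ⧸ c)
  · rintro ⟨φ, hφ⟩ s hs
    rw [← Submodule.Quotient.mk_eq_zero c, smul_eq_mul, mul_comm, ← smul_eq_mul,
      Submodule.Quotient.mk_smul, ← hφ, LinearMap.applyₗ_apply_apply, ← map_smul,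
      Algebra.smul_def, mul_one]
    exact (congrArg φ (Ideal.Quotient.eq_zero_iff_mem.mpr hs)).trans (map_zero φ)

theorem not_subsingleton_hom_quotient (hcJ : c ≤ J)
    (hI : Submodule.colon c J = I) (hI' : I ≠ ⊤) (hJ : Submodule.colon c I = J) :
    ¬ Subsingleton (R ⧸ I →ₗ[R] R ⧸ c) := by
  intro h
  refine hI' (hI ▸ (Submodule.colon_eq_top_iff_subset (J : Set R)).mpr fun y hy => ?_)
  obtain ⟨φ, hφ⟩ := (exact_applyₗ_one_factor hcJ hJ (Submodule.Quotient.mk y)).mp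
    ((Submodule.Quotient.mk_eq_zero J).mpr hy)
  rw [Subsingleton.elim φ 0] at hφ
  exact (Submodule.Quotient.mk_eq_zero c).mp hφ.symm

theorem IsDirectlyLinked.symm (h : IsDirectlyLinked R I J) : IsDirectlyLinked R J I := by
  obtain ⟨hI, hJ, c, hc, hcIJ, h1, h2⟩ := h
  exact ⟨hJ, hI, c, hc, inf_comm I J ▸ hcIJ, h2, h1⟩

theorem exists_isDirectlyLinked_of_inSameLinkageClass (h : InSameLinkageClass R I J) :
    I = J ∨ (∃ K, IsDirectlyLinked R I K) ∧ ∃ K, IsDirectlyLinked R J K := by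
  induction h with
  | rel I J h => exact .inr ⟨⟨J, h⟩, ⟨I, h.symm⟩⟩
  | refl I => exact .inl rfl
  | symm I J _ h => exact h.imp Eq.symm And.symm
  | trans I J K _ _ h1 h2 =>
    rcases h1 with rfl | h1
    · exact h2
    · rcases h2 with rfl | h2
      · exact .inr h1
      · exact .inr ⟨h1.1, h2.2⟩

theorem hasFiniteProjDim_quotient_ofList [IsLocalRing R] [IsNoetherianRing R] {rs : List R}
    (hrs : IsRegular R rs) : HasFiniteProjDim (ModuleCat.of R (R ⧸ Ideal.ofList rs)) := by
  refine .of_linearEquiv (X := ModuleCat.of R (Shrink.{0} (R ⧸ Ideal.ofList rs)))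
    (Shrink.linearEquiv R _) ⟨rs.length + 1, ?_⟩
  rw [← projectiveDimension_lt_iff, ModuleCat.projectiveDimension_quotient_eq_length rs hrs]
  exact_mod_cast Nat.lt_succ_self _

theorem IsDirectlyLinked.exists_isExtGrade (h : IsDirectlyLinked R I J) :
    ∃ g, IsExtGrade I g ∧ IsExtGrade J g := by
  obtain ⟨hI, hJ, _, ⟨-, rs, hrs, rfl⟩, hcIJ, h1, h2⟩ := h
  obtain ⟨hvI, ⟨eI⟩⟩ := ext_rees_quotient hrs.1 (hcIJ.trans inf_le_left)
  obtain ⟨hvJ, ⟨eJ⟩⟩ := ext_rees_quotient hrs.1 (hcIJ.trans inf_le_right)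
  refine ⟨rs.length, ⟨hvI, fun h => ?_⟩, ⟨hvJ, fun h => ?_⟩⟩
  · exact not_subsingleton_hom_quotient (hcIJ.trans inf_le_right) h1 hI h2
      eI.symm.injective.subsingleton
  · exact not_subsingleton_hom_quotient (hcIJ.trans inf_le_left) h2 hJ h1
      eJ.symm.injective.subsingleton

theorem IsDirectlyLinked.hasFiniteProjDim [IsLocalRing R] [IsNoetherianRing R] {g : ℕ}
    (hm : IsExtGrade (maximalIdeal R) g) (hI : IsExtGrade I g) (h : IsDirectlyLinked R I J)
    (hfpd : HasFiniteProjDim (ModuleCat.of R (R ⧸ I))) :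
    HasFiniteProjDim (ModuleCat.of R (R ⧸ J)) := by
  obtain ⟨hI', hJ, _, ⟨-, rs, hrs, rfl⟩, hcIJ, h1, h2⟩ := h
  obtain ⟨hvI, ⟨e⟩⟩ := ext_rees_quotient hrs.1 (hcIJ.trans inf_le_left)
  have hlen : rs.length = g := IsExtGrade.unique ⟨hvI, fun h =>
    not_subsingleton_hom_quotient (hcIJ.trans inf_le_right) h1 hI' h2
      e.symm.injective.subsingleton⟩ hI
  rw [hlen] at e hvI
  have hExt := hasFiniteProjDim_ext g (ModuleCat.of R (R ⧸ I))
    (hfpd.hasProjectiveDimensionLT hm.1 hm.2) hvI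
  have hHom : HasFiniteProjDim (ModuleCat.of R (R ⧸ I →ₗ[R] R ⧸ Ideal.ofList rs)) :=
    hExt.of_linearEquiv e
  exact HasFiniteProjDim.X₃ (X := ModuleCat.of R (R ⧸ I →ₗ[R] R ⧸ Ideal.ofList rs))
    (Y := ModuleCat.of R (R ⧸ Ideal.ofList rs)) (Z := ModuleCat.of R (R ⧸ J))
    applyₗ_one_injective_of_quotient (exact_applyₗ_one_factor (hcIJ.trans inf_le_right) h2)
    (Submodule.factor_surjective _) hHom (hasFiniteProjDim_quotient_ofList hrs)

theorem InSameLinkageClass.isExtGrade_iff {g : ℕ} (h : InSameLinkageClass R I J) :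
    IsExtGrade I g ↔ IsExtGrade J g := by
  induction h with
  | rel I J h =>
    obtain ⟨k, hI, hJ⟩ := h.exists_isExtGrade
    exact ⟨fun h => h.unique hI ▸ hJ, fun h => h.unique hJ ▸ hI⟩
  | refl I => rfl
  | symm I J _ h => exact h.symm
  | trans I J K _ _ h1 h2 => exact h1.trans h2

theorem InSameLinkageClass.hasFiniteProjDim_iff [IsLocalRing R] [IsNoetherianRing R] {g : ℕ}
    (hm : IsExtGrade (maximalIdeal R) g) (hI : IsExtGrade I g) (h : InSameLinkageClass R I J) :
    HasFiniteProjDim (ModuleCat.of R (R ⧸ I)) ↔ HasFiniteProjDim (ModuleCat.of R (R ⧸ J)) := by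
  induction h with
  | rel I J h =>
    exact ⟨h.hasFiniteProjDim hm hI, h.symm.hasFiniteProjDim hm
      ((InSameLinkageClass.isExtGrade_iff (.rel _ _ h)).mp hI)⟩
  | refl I => rfl
  | symm I J h ih => exact (ih ((InSameLinkageClass.isExtGrade_iff h).mpr hI)).symm
  | trans I J K h1 _ ih1 ih2 =>
    exact (ih1 hI).trans (ih2 ((InSameLinkageClass.isExtGrade_iff h1).mp hI))

theorem hasFiniteProjDim_residueField_of_licci [IsLocalRing R] [IsNoetherianRing R]
    (h : Licci R (maximalIdeal R)) :
    HasFiniteProjDim (ModuleCat.of R (R ⧸ maximalIdeal R)) := by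
  obtain ⟨J, hJ, -, rs, hrs, rfl⟩ := h
  have hfpd := hasFiniteProjDim_quotient_ofList hrs
  rcases exists_isDirectlyLinked_of_inSameLinkageClass hJ with h | ⟨⟨K, hK⟩, -⟩
  · rw [h]
    exact hfpd
  · obtain ⟨g, hg, -⟩ := hK.exists_isExtGrade
    exact (InSameLinkageClass.hasFiniteProjDim_iff hg hg hJ).mpr hfpd

end

section
variable {R : Type} [CommRing R]

theorem isWeaklyRegular_append_singleton_iff {rs : List R} {a : R} :
    IsWeaklyRegular R (rs ++ [a]) ↔
      IsWeaklyRegular R rs ∧ IsSMulRegular (R ⧸ Ideal.ofList rs) a := by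
  rw [isWeaklyRegular_append_iff, isWeaklyRegular_singleton_iff]
  have hc : Ideal.ofList rs • (⊤ : Submodule R R) = Ideal.ofList rs := Ideal.mul_top _
  rw [hc]

theorem mem_of_mul_mem_of_isSMulRegular_quotient {q : Ideal R} {a x : R}
    (ha : IsSMulRegular (R ⧸ q) a) (hx : a * x ∈ q) : x ∈ q :=
  mem_of_isSMulRegular_quotient_of_smul_mem ha hx

theorem colon_sup_span_mul {q : Ideal R} {a y : R} (hy : IsSMulRegular (R ⧸ q) y) :
    Submodule.colon (q ⊔ Ideal.span {a * y}) ((q ⊔ Ideal.span {y} : Ideal R) : Set R) =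
      q ⊔ Ideal.span {a} := by
  ext r
  rw [Submodule.mem_colon]
  constructor
  · intro h
    obtain ⟨u, hu, v, hv, huv⟩ := Submodule.mem_sup.mp
      (h y (Ideal.mem_sup_right (Ideal.mem_span_singleton_self y)))
    obtain ⟨t, rfl⟩ := Ideal.mem_span_singleton'.mp hv
    have hu' : y * (r - t * a) ∈ q := by
      have : y * (r - t * a) = u := by
        rw [smul_eq_mul] at huv
        linear_combination -huv
      rwa [this]
    exact Submodule.mem_sup.mpr ⟨_, mem_of_mul_mem_of_isSMulRegular_quotient hy hu', t * a,
      Ideal.mem_span_singleton'.mpr ⟨t, rfl⟩, sub_add_cancel r _⟩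
  · intro hr s hs
    obtain ⟨u, hu, v, hv, rfl⟩ := Submodule.mem_sup.mp hr
    obtain ⟨u', hu', v', hv', rfl⟩ := Submodule.mem_sup.mp hs
    obtain ⟨t, rfl⟩ := Ideal.mem_span_singleton'.mp hv
    obtain ⟨t', rfl⟩ := Ideal.mem_span_singleton'.mp hv'
    refine Submodule.mem_sup.mpr ⟨u * (u' + t' * y) + t * a * u',
      q.add_mem (q.mul_mem_right _ hu) (q.mul_mem_left _ hu'), t * t' * (a * y),
      Ideal.mem_span_singleton'.mpr ⟨_, rfl⟩, ?_⟩
    rw [smul_eq_mul]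
    ring

theorem ofList_ne_top_of_isRegular {rs : List R} (h : IsRegular R rs) : Ideal.ofList rs ≠ ⊤ :=
  fun h' => h.2 (by rw [h', smul_eq_mul, Ideal.mul_top])

theorem mem_maximalIdeal_of_isRegular [IsLocalRing R] {rs : List R} (h : IsRegular R rs) {r : R}
    (hr : r ∈ rs) : r ∈ maximalIdeal R :=
  le_maximalIdeal (ofList_ne_top_of_isRegular h) (Ideal.subset_span hr)

theorem isDirectlyLinked_ofList_append_singleton {rs : List R} {a y : R}
    (ha : IsRegular R (rs ++ [a])) (hy : IsRegular R (rs ++ [y])) :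
    IsDirectlyLinked R (Ideal.ofList (rs ++ [a])) (Ideal.ofList (rs ++ [y])) := by
  have ha' := isWeaklyRegular_append_singleton_iff.mp ha.1
  have hy' := isWeaklyRegular_append_singleton_iff.mp hy.1
  have hle : Ideal.ofList (rs ++ [a * y]) ≤
      Ideal.ofList (rs ++ [a]) ⊓ Ideal.ofList (rs ++ [y]) := by
    simp only [Ideal.ofList_append, Ideal.ofList_singleton]
    exact le_inf
      (sup_le_sup_left (Ideal.span_singleton_le_span_singleton.mpr (dvd_mul_right a y)) _)
      (sup_le_sup_left (Ideal.span_singleton_le_span_singleton.mpr (dvd_mul_left y a)) _)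
  have hc : Ideal.ofList (rs ++ [a * y]) ≠ ⊤ := fun h => ofList_ne_top_of_isRegular ha
    (top_le_iff.mp (h ▸ hle.trans inf_le_left))
  refine ⟨ofList_ne_top_of_isRegular ha, ofList_ne_top_of_isRegular hy,
    Ideal.ofList (rs ++ [a * y]), ⟨hc, rs ++ [a * y], ⟨?_, ?_⟩, rfl⟩, hle, ?_, ?_⟩
  · exact isWeaklyRegular_append_singleton_iff.mpr ⟨ha'.1, ha'.2.mul hy'.2⟩
  · rw [smul_eq_mul, Ideal.mul_top]
    exact hc.symm
  · simp only [Ideal.ofList_append, Ideal.ofList_singleton]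
    exact colon_sup_span_mul hy'.2
  · simp only [Ideal.ofList_append, Ideal.ofList_singleton]
    rw [mul_comm]
    exact colon_sup_span_mul ha'.2

theorem not_isDirectlyLinked_bot {J : Ideal R} : ¬ IsDirectlyLinked R ⊥ J := by
  rintro ⟨-, hJ, c, -, hc, h1, h2⟩
  obtain rfl : c = ⊥ := le_bot_iff.mp (hc.trans inf_le_left)
  exact hJ (h2 ▸ (Submodule.colon_eq_top_iff_subset _).mpr subset_rfl)

variable [IsNoetherianRing R]

theorem exists_mem_notMem_isSMulRegular {M : Type*} [AddCommGroup M] [Module R M]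
    [Module.Finite R M] {I J : Ideal R} (hI : ¬ J ≤ I)
    (hass : ∀ P ∈ associatedPrimes R M, ¬ J ≤ P) : ∃ x ∈ J, x ∉ I ∧ IsSMulRegular M x := by
  classical
  by_contra! hcon
  have hfin := associatedPrimes.finite R M
  have hsub : (J : Set R) ⊆
      ⋃ P ∈ (↑(insert I hfin.toFinset) : Set (Ideal R)), (P : Set R) := by
    intro y hy
    by_cases hyI : y ∈ I
    · exact Set.mem_biUnion (x := I) (by simp) hyI
    · have : y ∈ ⋃ P ∈ associatedPrimes R M, (P : Set R) := by
        rw [biUnion_associatedPrimes_eq_compl_regular]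
        exact hcon y hy hyI
      obtain ⟨P, hP, hyP⟩ := Set.mem_iUnion₂.mp this
      exact Set.mem_biUnion (x := P) (by simp [hP]) hyP
  obtain ⟨P, hP, hle⟩ := (Ideal.subset_union_prime (f := id) I I fun P hP hPI _ => by
    have hP' : P ∈ associatedPrimes R M := by simpa [hPI] using hP
    exact hP'.isPrime).mp hsub
  rcases Finset.mem_insert.mp hP with rfl | hP
  · exact hI hle
  · exact hass P (hfin.mem_toFinset.mp hP) hle

variable [IsLocalRing R]

theorem le_of_isRegular_append_singleton {rs : List R} {a : R} (ha : IsRegular R (rs ++ [a]))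
    {I : Ideal R} (h : ∀ y, IsRegular R (rs ++ [y]) → y ∈ I) : maximalIdeal R ≤ I := by
  have ha' := isWeaklyRegular_append_singleton_iff.mp ha.1
  have hmem : ∀ r ∈ rs ++ [a], r ∈ maximalIdeal R := fun r hr =>
    mem_maximalIdeal_of_isRegular ha hr
  by_contra hI
  obtain ⟨y, hy, hyI, hreg⟩ := exists_mem_notMem_isSMulRegular (M := R ⧸ Ideal.ofList rs) hI
    fun P hP hle => by
      have : a ∈ ⋃ P ∈ associatedPrimes R (R ⧸ Ideal.ofList rs), (P : Set R) :=
        Set.mem_biUnion hP (hle (hmem a (by simp)))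
      rw [biUnion_associatedPrimes_eq_compl_regular R] at this
      exact this ha'.2
  refine hyI (h y ?_)
  rw [IsLocalRing.isRegular_iff_isWeaklyRegular_of_subset_maximalIdeal]
  · exact isWeaklyRegular_append_singleton_iff.mpr ⟨ha'.1, hreg⟩
  · intro r hr
    rcases List.mem_append.mp hr with hr | hr
    · exact hmem r (List.mem_append_left _ hr)
    · rwa [List.mem_singleton.mp hr]

theorem eq_maximalIdeal_of_licci_of_maximalInLinkageClass {I : Ideal R} (hI : I ≠ ⊤)
    (hgrade : ∃ r ∈ I, r ∈ nonZeroDivisors R) (h : Licci R I) (hmax : MaximalInLinkageClass R I) :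
    I = maximalIdeal R := by
  refine le_antisymm (le_maximalIdeal hI) ?_
  obtain ⟨J, hJ, -, rs, hrs, rfl⟩ := h
  rcases List.eq_nil_or_concat' rs with rfl | ⟨rs, a, rfl⟩
  · rw [Ideal.ofList_nil] at hJ
    rcases exists_isDirectlyLinked_of_inSameLinkageClass hJ with rfl | ⟨-, K, hK⟩
    · obtain ⟨r, hr, hr'⟩ := hgrade
      exact absurd (Ideal.mem_bot.mp hr) (nonZeroDivisors.ne_zero hr')
    · exact absurd hK not_isDirectlyLinked_bot
  · refine le_of_isRegular_append_singleton hrs fun y hy => ?_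
    exact hmax _ (hJ.trans _ _ _ (.rel _ _ (isDirectlyLinked_ofList_append_singleton hrs hy)))
      (Ideal.subset_span (by simp))

end

section
variable {R : Type} [CommRing R]

theorem HasFiniteProjDim.quotSMulTop [IsNoetherianRing R] {x : R} (hx : IsSMulRegular R x) (n : ℕ)
    (M : ModuleCat.{0} R) [Module.Finite R M] (hM : IsSMulRegular M x)
    (h : HasProjectiveDimensionLT M (n + 1)) :
    HasFiniteProjDim (ModuleCat.of (R ⧸ Ideal.span {x}) (QuotSMulTop x M)) := by
  induction n generalizing M with
  | zero =>
    have : Module.Projective R M := (IsProjective.iff_projective _).mpr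
      (projective_iff_hasProjectiveDimensionLT_one.mpr h)
    have : Module.Projective (R ⧸ Ideal.span {x}) (QuotSMulTop x M) :=
      .of_equiv ((QuotSMulTop.equivQuotTensor x M).extendScalarsOfSurjective
        Ideal.Quotient.mk_surjective).symm
    exact .of_projective
  | succ n ih =>
    obtain ⟨m, f, hf⟩ := Module.Finite.exists_fin' R M
    have hS := LinearMap.shortExact_shortComplexKer hf
    have hF : IsSMulRegular (Fin m → R) x := .pi fun _ => hx
    have hK : IsSMulRegular (LinearMap.ker f) x := hF.submodule _ x
    have : Module.Finite R f.shortComplexKer.X₁ :=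
      inferInstanceAs (Module.Finite R (LinearMap.ker f))
    have hfp := ih f.shortComplexKer.X₁ hK
      ((hS.hasProjectiveDimensionLT_X₃_iff n inferInstance).mp h)
    have hsurj : Function.Surjective (algebraMap R (R ⧸ Ideal.span {x})) :=
      Ideal.Quotient.mk_surjective
    refine HasFiniteProjDim.X₃
      (X := ModuleCat.of (R ⧸ Ideal.span {x}) (QuotSMulTop x (LinearMap.ker f)))
      (Y := ModuleCat.of (R ⧸ Ideal.span {x}) (QuotSMulTop x (Fin m → R)))
      (f := (QuotSMulTop.map x (LinearMap.ker f).subtype).extendScalarsOfSurjective hsurj)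
      (g := (QuotSMulTop.map x f).extendScalarsOfSurjective hsurj)
      ?_ (QuotSMulTop.map_exact x (LinearMap.exact_subtype_ker_map f) hf)
      (QuotSMulTop.map_surjective x hf) hfp .of_projective
    have h0 : Function.Exact (0 : LinearMap.ker f →ₗ[R] LinearMap.ker f)
        (LinearMap.ker f).subtype :=
      (LinearMap.exact_zero_iff_injective _ _).mpr (Submodule.injective_subtype _)
    have := QuotSMulTop.map_first_exact_on_four_term_exact_of_isSMulRegular_last h0
      (LinearMap.exact_subtype_ker_map f) hM
    rw [map_zero] at this
    exact (LinearMap.exact_zero_iff_injective _ _).mp this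

theorem ringKrullDim_quotient_span_singleton_lt {x : R} {n : ℕ} (hx : IsSMulRegular R x)
    (h : ringKrullDim R < (n + 1 : ℕ)) : ringKrullDim (R ⧸ Ideal.span {x}) < n := by
  have hx' : x ∈ nonZeroDivisors R := mem_nonZeroDivisors_iff_right.mpr fun z hz =>
    hx (show x * z = x * 0 by rw [mul_zero, mul_comm, hz])
  have := (ringKrullDim_quotient_succ_le_of_nonZeroDivisor hx').trans_lt h
  rw [Nat.cast_add, Nat.cast_one] at this
  exact lt_of_add_lt_add_right this

variable [IsLocalRing R]

theorem exists_linearMap_quotient_eq_one {x : maximalIdeal R}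
    (hx : (x : R) ∉ maximalIdeal R ^ 2) :
    ∃ φ : maximalIdeal R →ₗ[R] R ⧸ maximalIdeal R, φ x = 1 := by
  have hx' : (maximalIdeal R).toCotangent x ≠ 0 := fun h =>
    hx ((Ideal.toCotangent_eq_zero _ x).mp h)
  obtain ⟨f, hf⟩ := Module.Projective.exists_dual_eq_one (ResidueField R)
    (V := CotangentSpace R) hx'
  exact ⟨(f.restrictScalars R).comp (maximalIdeal R).toCotangent, hf⟩

open scoped Pointwise in
theorem exists_isRegular_of_quotient {x : R} (hreg : IsSMulRegular R x)
    [IsLocalRing (R ⧸ Ideal.span {x})]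
    (h : ∃ rs : List (R ⧸ Ideal.span {x}), IsRegular (R ⧸ Ideal.span {x}) rs ∧
      Ideal.ofList rs = maximalIdeal (R ⧸ Ideal.span {x})) :
    ∃ rs : List R, IsRegular R rs ∧ Ideal.ofList rs = maximalIdeal R := by
  have hsurj : Function.Surjective (Ideal.Quotient.mk (Ideal.span {x})) :=
    Ideal.Quotient.mk_surjective
  obtain ⟨rs, hrs, hrsm⟩ := h
  obtain ⟨rs, rfl⟩ := List.map_surjective_iff.mpr hsurj rs
  have hmax : Ideal.ofList (x :: rs) = maximalIdeal R := by
    have := IsLocalHom.of_surjective _ hsurj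
    rw [← maximalIdeal_comap (Ideal.Quotient.mk (Ideal.span {x})), ← hrsm, ← Ideal.map_ofList,
      Ideal.comap_map_of_surjective' _ hsurj, Ideal.mk_ker, Ideal.ofList_cons, sup_comm]
  refine ⟨x :: rs, ?_, hmax⟩
  rw [IsLocalRing.isRegular_iff_isWeaklyRegular_of_subset_maximalIdeal
    fun r hr => hmax ▸ Ideal.subset_span hr, isWeaklyRegular_cons_iff]
  refine ⟨hreg, ?_⟩
  have hspan : x • (⊤ : Submodule R R) = Ideal.span {x} := by
    rw [← Submodule.ideal_span_singleton_smul, smul_eq_mul, Ideal.mul_top]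
  exact ((Submodule.quotEquivOfEq _ _ hspan).isWeaklyRegular_congr rs).mpr
    ((isWeaklyRegular_map_algebraMap_iff (R ⧸ Ideal.span {x}) _ rs).mp hrs.1)

variable [IsNoetherianRing R]

theorem hasFiniteProjDim_quotient_maximalIdeal {x : maximalIdeal R}
    [IsLocalRing (R ⧸ Ideal.span {(x : R)})]
    (hx : (x : R) ∉ maximalIdeal R ^ 2) (hreg : IsSMulRegular R (x : R))
    (h : HasFiniteProjDim (ModuleCat.of R (R ⧸ maximalIdeal R))) :
    HasFiniteProjDim (ModuleCat.of (R ⧸ Ideal.span {(x : R)})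
      ((R ⧸ Ideal.span {(x : R)}) ⧸ maximalIdeal (R ⧸ Ideal.span {(x : R)}))) := by
  have hsurj : Function.Surjective (algebraMap R (R ⧸ Ideal.span {(x : R)})) :=
    Ideal.Quotient.mk_surjective
  have hcomap : (maximalIdeal (R ⧸ Ideal.span {(x : R)})).comap
      (algebraMap R (R ⧸ Ideal.span {(x : R)})) = maximalIdeal R := by
    have := IsLocalHom.of_surjective _ hsurj
    exact maximalIdeal_comap _
  obtain ⟨n, hn⟩ : HasFiniteProjDim (ModuleCat.of R (maximalIdeal R)) :=
    .X₁ (Y := ModuleCat.of R R) (Z := ModuleCat.of R (R ⧸ maximalIdeal R))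
      (f := (maximalIdeal R).subtype) (g := (maximalIdeal R).mkQ)
      (Submodule.injective_subtype _) (LinearMap.exact_subtype_mkQ _)
      (Submodule.mkQ_surjective _) .of_projective h
  obtain ⟨m, hm⟩ := HasFiniteProjDim.quotSMulTop hreg n (ModuleCat.of R (maximalIdeal R))
    (hreg.submodule _ _) (hasProjectiveDimensionLT_of_ge _ n _ n.le_succ)
  refine ⟨m, ?_⟩
  obtain ⟨φ, hφ⟩ := exists_linearMap_quotient_eq_one hx
  let i : ((R ⧸ Ideal.span {(x : R)}) ⧸ maximalIdeal (R ⧸ Ideal.span {(x : R)}))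
      →ₗ[R ⧸ Ideal.span {(x : R)}] QuotSMulTop (x : R) (maximalIdeal R) :=
    Submodule.liftQ _ (LinearMap.toSpanSingleton _ _ (Submodule.Quotient.mk x)) (by
      intro a ha
      obtain ⟨a, rfl⟩ := hsurj a
      have ha : a ∈ maximalIdeal R := hcomap ▸ ha
      rw [LinearMap.mem_ker, LinearMap.toSpanSingleton_apply, algebraMap_smul,
        ← Submodule.Quotient.mk_smul, Submodule.Quotient.mk_eq_zero]
      have : a • x = (x : R) • (⟨a, ha⟩ : maximalIdeal R) := Subtype.ext (mul_comm _ _)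
      rw [this]
      exact Submodule.smul_mem_pointwise_smul _ _ _ trivial)
  let ψ : (R ⧸ maximalIdeal R) →ₗ[R]
      ((R ⧸ Ideal.span {(x : R)}) ⧸ maximalIdeal (R ⧸ Ideal.span {(x : R)})) :=
    Submodule.liftQ _ (Algebra.linearMap R _) (by
      intro a ha
      rw [← hcomap] at ha
      exact Ideal.Quotient.eq_zero_iff_mem.mpr ha)
  let p : QuotSMulTop (x : R) (maximalIdeal R) →ₗ[R]
      ((R ⧸ Ideal.span {(x : R)}) ⧸ maximalIdeal (R ⧸ Ideal.span {(x : R)})) :=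
    Submodule.liftQ _ (ψ.comp φ) (by
      intro a ha
      obtain ⟨b, -, rfl⟩ := (Submodule.mem_smul_pointwise_iff_exists _ _ _).mp ha
      rw [LinearMap.mem_ker, LinearMap.map_smul, algebra_compatible_smul
        (R ⧸ Ideal.span {(x : R)}), Ideal.Quotient.algebraMap_eq,
        Ideal.Quotient.eq_zero_iff_mem.mpr (Ideal.mem_span_singleton_self _), zero_smul])
  have hψ : ψ 1 = 1 := map_one (algebraMap R _)
  exact Retract.hasProjectiveDimensionLT
    (Y := ModuleCat.of (R ⧸ Ideal.span {(x : R)}) (QuotSMulTop (x : R) (maximalIdeal R)))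
    { i := ModuleCat.ofHom i
      r := ModuleCat.ofHom (p.extendScalarsOfSurjective hsurj)
      retract := by
        refine ModuleCat.hom_ext (applyₗ_one_injective_of_quotient ?_)
        change p (i 1) = 1
        have : i 1 = Submodule.Quotient.mk x :=
          one_smul (R ⧸ Ideal.span {(x : R)}) (Submodule.Quotient.mk x : QuotSMulTop (x : R) _)
        rw [this]
        exact (congrArg ψ hφ).trans hψ } m

theorem maximalIdeal_eq_bot_of_mem_associatedPrimes
    (hass : maximalIdeal R ∈ associatedPrimes R R)
    (h : HasFiniteProjDim (ModuleCat.of R (R ⧸ maximalIdeal R))) : maximalIdeal R = ⊥ := by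
  obtain ⟨hprime, s, hs⟩ := (isAssociatedPrime_iff.mp hass)
  have hs0 : s ≠ 0 := fun h0 => hprime.ne_top (by rw [hs, h0, Submodule.colon_singleton_zero])
  have hg : ¬ Subsingleton (Ext (ModuleCat.of R (R ⧸ maximalIdeal R)) (ModuleCat.of R R) 0) := by
    intro hsub
    have : Subsingleton ((R ⧸ maximalIdeal R) →ₗ[R] R) :=
      ((Ext.linearEquiv₀ (R := R) (X := ModuleCat.of R (R ⧸ maximalIdeal R))
        (Y := ModuleCat.of R R)).trans ModuleCat.homLinearEquiv).symm.injective.subsingleton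
    let φ : (R ⧸ maximalIdeal R) →ₗ[R] R :=
      Submodule.liftQ _ (LinearMap.toSpanSingleton R R s) (by
        intro a ha
        rw [hs] at ha
        exact Submodule.mem_colon_singleton.mp ha)
    have h1 : φ 1 = s := one_smul R s
    exact hs0 (by rw [← h1, Subsingleton.elim φ 0, LinearMap.zero_apply])
  have : Module.Projective R (R ⧸ maximalIdeal R) :=
    (IsProjective.iff_projective (ModuleCat.of R (R ⧸ maximalIdeal R))).mpr
      (projective_iff_hasProjectiveDimensionLT_one.mpr
        (h.hasProjectiveDimensionLT (g := 0) (by simp) hg))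
  have : Module.Free R (R ⧸ maximalIdeal R) := Module.free_of_flat_of_isLocalRing
  have := Module.Free.instFaithfulSMulOfNontrivial R (R ⧸ maximalIdeal R)
  rw [← Ideal.annihilator_quotient (I := maximalIdeal R), Module.annihilator_eq_bot]
  exact this

theorem exists_isRegular_ofList_eq_maximalIdeal (n : ℕ) :
    ∀ (R : Type) [CommRing R] [IsLocalRing R] [IsNoetherianRing R],
      HasFiniteProjDim (ModuleCat.of R (R ⧸ maximalIdeal R)) → ringKrullDim R < n →
      ∃ rs : List R, IsRegular R rs ∧ Ideal.ofList rs = maximalIdeal R := by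
  induction n with
  | zero =>
    intro R _ _ _ _ hdim
    exact absurd hdim (not_lt.mpr ringKrullDim_nonneg_of_nontrivial)
  | succ n ih =>
    intro R _ _ _ h hdim
    by_cases hbot : maximalIdeal R = ⊥
    · exact ⟨[], .nil R R, by rw [Ideal.ofList_nil, hbot]⟩
    have hsq : ¬ maximalIdeal R ≤ maximalIdeal R ^ 2 := fun hle =>
      hbot (Submodule.eq_bot_of_le_smul_of_le_jacobson_bot (maximalIdeal R) _
        (IsNoetherian.noetherian _) (by rwa [smul_eq_mul, ← sq]) (maximalIdeal_le_jacobson _))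
    have hass : ∀ P ∈ associatedPrimes R R, ¬ maximalIdeal R ≤ P := fun P hP hle => by
      obtain rfl := (IsLocalRing.maximalIdeal.isMaximal R).eq_of_le hP.isPrime.ne_top hle
      exact hbot (maximalIdeal_eq_bot_of_mem_associatedPrimes hP h)
    obtain ⟨x, hxm, hx2, hreg⟩ := exists_mem_notMem_isSMulRegular hsq hass
    have hne : Ideal.span {x} ≠ ⊤ := fun h => (IsLocalRing.maximalIdeal.isMaximal R).ne_top
      (top_le_iff.mp (h ▸ (Ideal.span_singleton_le_iff_mem _).mpr hxm))
    have : Nontrivial (R ⧸ Ideal.span {x}) := Ideal.Quotient.nontrivial_iff.mpr hne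
    have : IsLocalRing (R ⧸ Ideal.span {x}) := .of_surjective' _ Ideal.Quotient.mk_surjective
    exact exists_isRegular_of_quotient hreg (ih (R ⧸ Ideal.span {x})
      (hasFiniteProjDim_quotient_maximalIdeal (x := ⟨x, hxm⟩) hx2 hreg h)
      (ringKrullDim_quotient_span_singleton_lt hreg hdim))

/-- A Noetherian local ring whose residue field has finite projective dimension is regular. -/
theorem isRegularLocalRingP_of_hasFiniteProjDim
    (h : HasFiniteProjDim (ModuleCat.of R (R ⧸ maximalIdeal R))) : IsRegularLocalRingP R := by
  obtain ⟨n, hn⟩ : ∃ n : ℕ, ringKrullDim R < n := by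
    obtain ⟨d, hd⟩ := WithBot.ne_bot_iff_exists.mp (ringKrullDim_ne_bot (R := R))
    have hlt := ringKrullDim_lt_top (R := R)
    rw [← hd] at hlt ⊢
    obtain ⟨n, hn⟩ := ENat.exists_nat_gt (WithBot.coe_lt_coe.mp hlt).ne
    exact ⟨n, WithBot.coe_lt_coe.mpr hn⟩
  exact ⟨inferInstance, exists_isRegular_ofList_eq_maximalIdeal n R h hn⟩

end

end

/-- Lemma 2.7. Let `I` be a Cohen-Macaulay ideal of positive grade in a
Noetherian local Gorenstein ring with infinite residue field. Then `∫I = I` if and only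
if `I` is maximal in its linkage class and `I` is not the maximal ideal of a regular
local ring. -/
theorem statement6 (R : Type) [CommRing R] [IsLocalRing R] [IsNoetherianRing R]
    (hGor : IsGorensteinLocalRing R) (hres : Infinite (IsLocalRing.ResidueField R))
    (I : Ideal R) (hCM : IsCMIdeal R I) (hgrade : ∃ r ∈ I, r ∈ nonZeroDivisors R) :
    intLink R I = I ↔
      (MaximalInLinkageClass R I ∧
        ¬(IsRegularLocalRingP R ∧ I = IsLocalRing.maximalIdeal R)) := by
  have hI : I ≠ ⊤ := by
    obtain ⟨h, -⟩ := hCM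
    exact Ideal.Quotient.nontrivial_iff.mp h.toNontrivial
  constructor
  · intro h
    have hlicci : ¬ Licci R I := fun hl => hI (by rw [← h, intLink, if_pos hl])
    refine ⟨fun J hJ => ?_, ?_⟩
    · rw [← h, intLink, if_neg hlicci]
      exact le_sSup hJ
    · rintro ⟨⟨-, rs, hrs, hrsm⟩, rfl⟩
      exact hlicci ⟨_, .refl _, hI, rs, hrs, hrsm⟩
  · rintro ⟨hmax, hreg⟩
    have hlicci : ¬ Licci R I := fun hl => by
      obtain rfl := eq_maximalIdeal_of_licci_of_maximalInLinkageClass hI hgrade hl hmax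
      exact hreg ⟨isRegularLocalRingP_of_hasFiniteProjDim
        (hasFiniteProjDim_residueField_of_licci hl), rfl⟩
    rw [intLink, if_neg hlicci]
    exact le_antisymm (sSup_le hmax) (le_sSup (.refl I))
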